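/- Let T be a bounded linear operator on a nontrivial complex Hilbert space H, let α, β ≥ 0 with α + β ≥ 1, let s ≥ 1, and let p, q > 1 with 1/p + 1/q = 1; set r₀ = min{1/p, 1/q}. Then w^{2s}(T|T|^{α+β−1}) ≤ ‖ (1/p)|T|^{2spα} + (1/q)|T*|^{2sqβ} ‖ − r₀ · inf_{‖x‖=1} ( ⟨|T|^{2sα}x, x⟩^{p/2} − ⟨|T*|^{2sβ}x, x⟩^{q/2} )². -/

import Mathlib

open scoped InnerProductSpace NNReal

variable {H : Type*} [NormedAddCommGroup H] [InnerProductSpace ℂ H] [CompleteSpace H]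

/-- The numerical radius `w(T) = sup { |⟨Tx, x⟩| : ‖x‖ = 1 }`. -/
noncomputable def numRadius (T : H →L[ℂ] H) : ℝ :=
  ⨆ x : {x : H // ‖x‖ = 1}, ‖⟪T x.1, x.1⟫_ℂ‖

/-- The absolute value `|T| = (T*T)^(1/2)`. -/
noncomputable def opAbs (T : H →L[ℂ] H) : H →L[ℂ] H :=
  CFC.sqrt (star T * T)

/-- The real power `|T|^s` of the absolute value, via the continuous functional calculus. -/
noncomputable def opAbsPow (T : H →L[ℂ] H) (s : ℝ) : H →L[ℂ] H :=
  CFC.rpow (opAbs T) s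

theorem mul_cfc_eq_cfc_mul {A : Type*} [CStarAlgebra A] {a b t : A} (ha : IsSelfAdjoint a)
    (hb : IsSelfAdjoint b) (h : t * a = b * t) {f : ℝ → ℝ} (hf : Continuous f) :
    t * cfc f a = cfc f b * t := by
  have has : spectrum ℝ a ⊆ spectrum ℝ a ∪ spectrum ℝ b := Set.subset_union_left
  have hbs : spectrum ℝ b ⊆ spectrum ℝ a ∪ spectrum ℝ b := Set.subset_union_right
  have : CompactSpace (spectrum ℝ a ∪ spectrum ℝ b : Set ℝ) :=
    isCompact_iff_compactSpace.mp ((ContinuousFunctionalCalculus.isCompact_spectrum a).union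
      (ContinuousFunctionalCalculus.isCompact_spectrum b))
  have key : ∀ g : C((spectrum ℝ a ∪ spectrum ℝ b : Set ℝ), ℝ),
      t * cfcHomSuperset ha has g = cfcHomSuperset hb hbs g * t := by
    intro g
    induction g using ContinuousMap.induction_on_of_compact with
    | const r =>
      have hr : ContinuousMap.const (spectrum ℝ a ∪ spectrum ℝ b : Set ℝ) r
          = algebraMap ℝ _ r := rfl
      rw [hr, AlgHomClass.commutes, AlgHomClass.commutes]
      exact (Algebra.commutes r t).symm
    | id => rw [cfcHomSuperset_id, cfcHomSuperset_id]; exact h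
    | star_id =>
      rw [map_star, map_star, cfcHomSuperset_id, cfcHomSuperset_id, ha.star_eq, hb.star_eq, h]
    | add f g hf hg => rw [map_add, map_add, mul_add, add_mul, hf, hg]
    | mul f g hf hg => rw [map_mul, map_mul, ← mul_assoc, hf, mul_assoc, hg, mul_assoc]
    | frequently f hf =>
      exact hf.mem_of_closed (isClosed_eq
        (continuous_const.mul (cfcHomSuperset_continuous ha has))
        ((cfcHomSuperset_continuous hb hbs).mul continuous_const))
  have := key ⟨_, hf.continuousOn.domRestrict⟩
  rw [cfcHomSuperset_apply, cfcHomSuperset_apply] at this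
  rw [cfc_apply f a ha hf.continuousOn, cfc_apply f b hb hf.continuousOn]
  exact this

theorem opAbs_nonneg (T : H →L[ℂ] H) : 0 ≤ opAbs T := CFC.sqrt_nonneg _

theorem opAbsPow_nonneg (T : H →L[ℂ] H) (s : ℝ) : 0 ≤ opAbsPow T s := CFC.rpow_nonneg

theorem opAbsPow_eq_cfc (T : H →L[ℂ] H) (s : ℝ) :
    opAbsPow T s = cfc (fun x : ℝ => x ^ s) (opAbs T) :=
  CFC.rpow_eq_cfc_real (opAbs_nonneg T)

theorem opAbsPow_rpow (T : H →L[ℂ] H) {r s : ℝ} (hr : 0 ≤ r) (hs : 0 ≤ s) :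
    opAbsPow T r ^ s = opAbsPow T (r * s) :=
  CFC.rpow_rpow_of_exponent_nonneg _ _ _ hr hs (opAbs_nonneg T)

theorem opAbsPow_add (T : H →L[ℂ] H) {r s : ℝ} (hr : 0 ≤ r) (hs : 0 ≤ s) :
    opAbsPow T (r + s) = opAbsPow T r * opAbsPow T s := by
  have h0 := opAbs_nonneg T
  rw [opAbsPow_eq_cfc, opAbsPow_eq_cfc, opAbsPow_eq_cfc, ← cfc_mul _ _ _
    (Real.continuous_rpow_const hr).continuousOn (Real.continuous_rpow_const hs).continuousOn]
  exact cfc_congr fun x hx => Real.rpow_add_of_nonneg (spectrum_nonneg_of_nonneg h0 hx) hr hs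

theorem opAbs_mul_self (T : H →L[ℂ] H) : opAbs T * opAbs T = star T * T :=
  CFC.sqrt_mul_sqrt_self _ (star_mul_self_nonneg T)

theorem mul_sqrt_star_mul_self {A : Type*} [CStarAlgebra A] [PartialOrder A] [StarOrderedRing A]
    (t : A) : t * CFC.sqrt (star t * t) = CFC.sqrt (t * star t) * t := by
  rw [CFC.sqrt_eq_real_sqrt _ (star_mul_self_nonneg t),
    CFC.sqrt_eq_real_sqrt _ (mul_star_self_nonneg t), cfcₙ_eq_cfc, cfcₙ_eq_cfc]
  have h : t * (star t * t) = t * star t * t := (mul_assoc _ _ _).symm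
  exact mul_cfc_eq_cfc_mul (IsSelfAdjoint.star_mul_self t) (IsSelfAdjoint.mul_star_self t) h
    Real.continuous_sqrt

theorem mul_opAbs (T : H →L[ℂ] H) : T * opAbs T = opAbs (star T) * T := by
  unfold opAbs
  rw [star_star]
  exact mul_sqrt_star_mul_self T

theorem mul_opAbsPow (T : H →L[ℂ] H) {s : ℝ} (hs : 0 ≤ s) :
    T * opAbsPow T s = opAbsPow (star T) s * T := by
  rw [opAbsPow_eq_cfc, opAbsPow_eq_cfc]
  exact mul_cfc_eq_cfc_mul (opAbs_nonneg T).isSelfAdjoint (opAbs_nonneg (star T)).isSelfAdjoint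
    (mul_opAbs T) (Real.continuous_rpow_const hs)

theorem norm_opAbs_apply (T : H →L[ℂ] H) (x : H) : ‖opAbs T x‖ = ‖T x‖ := by
  have h1 : ⟪opAbs T x, opAbs T x⟫_ℂ = ⟪T x, T x⟫_ℂ := by
    rw [← ContinuousLinearMap.adjoint_inner_left, ← ContinuousLinearMap.star_eq_adjoint,
      (opAbs_nonneg T).isSelfAdjoint.star_eq, ← ContinuousLinearMap.adjoint_inner_left T,
      ← ContinuousLinearMap.star_eq_adjoint]
    exact congrArg (fun S : H →L[ℂ] H => ⟪S x, x⟫_ℂ) (opAbs_mul_self T)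
  rw [@norm_eq_sqrt_re_inner ℂ, @norm_eq_sqrt_re_inner ℂ, h1]

theorem norm_opAbsPow_apply_sq (T : H →L[ℂ] H) {r : ℝ} (hr : 0 ≤ r) (x : H) :
    ‖opAbsPow T r x‖ ^ 2 = (⟪opAbsPow T (2 * r) x, x⟫_ℂ).re := by
  have h : ⟪opAbsPow T (2 * r) x, x⟫_ℂ = ⟪opAbsPow T r x, opAbsPow T r x⟫_ℂ := by
    rw [← ContinuousLinearMap.adjoint_inner_left, ← ContinuousLinearMap.star_eq_adjoint,
      (opAbsPow_nonneg T r).isSelfAdjoint.star_eq, two_mul, opAbsPow_add T hr hr]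
    rfl
  rw [h, @norm_sq_eq_re_inner ℂ]
  rfl

theorem exists_mul_opAbsPow_eq (T : H →L[ℂ] H) {α β : ℝ} (hα : 0 ≤ α) (hβ : 0 ≤ β)
    (hαβ : 1 ≤ α + β) {ε : ℝ} (hε : 0 < ε) :
    ∃ W : H →L[ℂ] H, ‖W‖ ≤ 1 ∧ T * opAbsPow T (α + β - 1) =
      opAbsPow (star T) β * W * opAbsPow T α + ε • (W * opAbsPow T (α + β - 1)) := by
  have h0 := opAbs_nonneg T
  have hpos : ∀ x ∈ spectrum ℝ (opAbs T), 0 ≤ x := fun x hx => spectrum_nonneg_of_nonneg h0 hx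
  have hc : ContinuousOn (fun x : ℝ => (x + ε)⁻¹) (spectrum ℝ (opAbs T)) :=
    ContinuousOn.inv₀ (by fun_prop) fun x hx => by linarith [hpos x hx]
  have hr : ∀ {r : ℝ}, 0 ≤ r → ContinuousOn (fun x : ℝ => x ^ r) (spectrum ℝ (opAbs T)) :=
    fun h => (Real.continuous_rpow_const h).continuousOn
  have hαβ' : 0 ≤ α + β - 1 := by linarith
  set R := cfc (fun x : ℝ => (x + ε)⁻¹) (opAbs T) with hR
  refine ⟨T * R, ?_, ?_⟩
  · have hn : ‖opAbs T * R‖ ≤ 1 := by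
      nth_rw 1 [← cfc_id' ℝ (opAbs T) h0.isSelfAdjoint]
      rw [← cfc_mul _ _ _ (by fun_prop) hc]
      refine norm_cfc_le zero_le_one fun x hx => ?_
      have := hpos x hx
      rw [Real.norm_of_nonneg (by positivity), ← div_eq_mul_inv, div_le_one (by positivity)]
      linarith
    refine ContinuousLinearMap.opNorm_le_bound _ zero_le_one fun x => ?_
    have : ‖(T * R) x‖ = ‖(opAbs T * R) x‖ := (norm_opAbs_apply T (R x)).symm
    rw [this]
    exact (opAbs T * R).le_of_opNorm_le hn x
  · rw [← mul_assoc, ← mul_opAbsPow T hβ]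
    simp only [mul_assoc]
    rw [← mul_smul_comm, ← mul_add]
    congr 1
    rw [hR, opAbsPow_eq_cfc, opAbsPow_eq_cfc, opAbsPow_eq_cfc,
      ← cfc_mul _ _ _ hc (hr hα),
      ← cfc_mul _ (fun x : ℝ => (x + ε)⁻¹ * x ^ α) _ (hr hβ) (hc.mul (hr hα)),
      ← cfc_mul _ _ _ hc (hr hαβ'),
      ← cfc_smul _ (fun x : ℝ => (x + ε)⁻¹ * x ^ (α + β - 1)) _ (hc.mul (hr hαβ')),
      ← cfc_add (opAbs T) (fun x : ℝ => x ^ β * ((x + ε)⁻¹ * x ^ α))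
        (fun x : ℝ => ε • ((x + ε)⁻¹ * x ^ (α + β - 1)))
        ((hr hβ).mul (hc.mul (hr hα))) ((hc.mul (hr hαβ')).const_smul ε)]
    refine cfc_congr fun x hx => ?_
    have hx0 := hpos x hx
    have h1 : x ^ β * x ^ α = x ^ (α + β - 1) * x := by
      rw [← Real.rpow_add_of_nonneg hx0 hβ hα]
      nth_rw 3 [← Real.rpow_one x]
      rw [← Real.rpow_add_of_nonneg hx0 hαβ' zero_le_one]
      congr 1; ring
    have h2 : x + ε ≠ 0 := by positivity
    simp only [smul_eq_mul]
    rw [show x ^ β * ((x + ε)⁻¹ * x ^ α) = (x + ε)⁻¹ * (x ^ β * x ^ α) by ring, h1]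
    field_simp

theorem norm_inner_mul_opAbsPow_le (T : H →L[ℂ] H) {α β : ℝ} (hα : 0 ≤ α) (hβ : 0 ≤ β)
    (hαβ : 1 ≤ α + β) (x y : H) :
    ‖⟪(T * opAbsPow T (α + β - 1)) x, y⟫_ℂ‖ ≤ ‖opAbsPow T α x‖ * ‖opAbsPow (star T) β y‖ := by
  set C := ‖opAbsPow T (α + β - 1) x‖ * ‖y‖ with hC
  have hlim : Filter.Tendsto (fun ε : ℝ => ‖opAbsPow T α x‖ * ‖opAbsPow (star T) β y‖ + ε * C)
      (nhdsWithin 0 (Set.Ioi 0)) (nhds (‖opAbsPow T α x‖ * ‖opAbsPow (star T) β y‖)) := by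
    refine tendsto_nhdsWithin_of_tendsto_nhds ?_
    exact Continuous.tendsto' (by fun_prop) _ _ (by simp)
  refine ge_of_tendsto hlim (Filter.eventually_of_mem self_mem_nhdsWithin fun ε hε => ?_)
  obtain ⟨W, hW, h⟩ := exists_mul_opAbsPow_eq T hα hβ hαβ hε
  have hW' : ∀ z, ‖W z‖ ≤ ‖z‖ := fun z => by simpa using W.le_of_opNorm_le hW z
  have h1 : ⟪(opAbsPow (star T) β * W * opAbsPow T α) x, y⟫_ℂ =
      ⟪W (opAbsPow T α x), opAbsPow (star T) β y⟫_ℂ := by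
    rw [← ContinuousLinearMap.adjoint_inner_left, ← ContinuousLinearMap.star_eq_adjoint,
      (opAbsPow_nonneg (star T) β).isSelfAdjoint.star_eq]
    rfl
  have h2 : ‖(ε • (W * opAbsPow T (α + β - 1))) x‖ ≤ ε * ‖opAbsPow T (α + β - 1) x‖ := by
    rw [smul_apply, norm_smul, Real.norm_of_nonneg (le_of_lt hε)]
    exact mul_le_mul_of_nonneg_left (hW' _) (le_of_lt hε)
  rw [h, add_apply, inner_add_left, h1]
  refine (norm_add_le _ _).trans (add_le_add ?_ ?_)
  · exact (norm_inner_le_norm _ _).trans (mul_le_mul_of_nonneg_right (hW' _) (norm_nonneg _))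
  · refine (norm_inner_le_norm _ _).trans ?_
    rw [hC, ← mul_assoc]
    exact mul_le_mul_of_nonneg_right h2 (norm_nonneg _)

omit [CompleteSpace H] in
theorem re_inner_nonneg {A : H →L[ℂ] H} (hA : 0 ≤ A) (x : H) : 0 ≤ (⟪A x, x⟫_ℂ).re :=
  ((ContinuousLinearMap.nonneg_iff_isPositive A).mp hA).re_inner_nonneg_left x

theorem re_inner_rpow_le {A : H →L[ℂ] H} (hA : 0 ≤ A) {r : ℝ} (hr : 1 ≤ r) {x : H}
    (hx : ‖x‖ = 1) : (⟪A x, x⟫_ℂ).re ^ r ≤ (⟪(A ^ r) x, x⟫_ℂ).re := by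
  have hr0 : 0 < r := by linarith
  set l := (⟪A x, x⟫_ℂ).re with hl
  rcases (re_inner_nonneg hA x).eq_or_lt with h0 | h0
  · rw [← hl] at h0
    rw [← h0, Real.zero_rpow hr0.ne']
    exact re_inner_nonneg CFC.rpow_nonneg x
  rw [← hl] at h0
  have hle : (l ^ r * (1 - r)) • (1 : H →L[ℂ] H) + (l ^ r * r / l) • A ≤ A ^ r := by
    have h1 : (l ^ r * (1 - r)) • (1 : H →L[ℂ] H) + (l ^ r * r / l) • A =
        cfc (fun t : ℝ => l ^ r * (1 - r) + l ^ r * r / l * t) A := by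
      rw [cfc_add (R := ℝ) A (fun _ => l ^ r * (1 - r)) (fun t => l ^ r * r / l * t),
        cfc_const _ A hA.isSelfAdjoint, cfc_const_mul_id _ A hA.isSelfAdjoint,
        Algebra.algebraMap_eq_smul_one]
    rw [h1, CFC.rpow_eq_cfc_real hA]
    refine cfc_mono (fun t ht => ?_) (by fun_prop)
      (Real.continuous_rpow_const hr0.le).continuousOn
    have ht0 : 0 ≤ t := spectrum_nonneg_of_nonneg hA ht
    have hb := one_add_mul_self_le_rpow_one_add (s := t / l - 1)
      (by linarith [div_nonneg ht0 h0.le]) hr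
    rw [add_sub_cancel, Real.div_rpow ht0 h0.le, le_div_iff₀ (by positivity)] at hb
    calc _ = (1 + r * (t / l - 1)) * l ^ r := by ring
      _ ≤ _ := hb
  have h2 := re_inner_nonneg (sub_nonneg.mpr hle) x
  have hxx : ⟪x, x⟫_ℂ = 1 := by simp [inner_self_eq_norm_sq_to_K, hx]
  have h3 : (⟪((l ^ r * (1 - r)) • (1 : H →L[ℂ] H) + (l ^ r * r / l) • A) x, x⟫_ℂ).re = l ^ r := by
    simp only [add_apply, smul_apply,
      one_apply_eq_self, inner_add_left, ← Complex.coe_smul, inner_smul_left,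
      Complex.conj_ofReal, hxx, Complex.add_re, Complex.re_ofReal_mul, Complex.one_re, ← hl]
    field_simp
    ring
  rw [sub_apply, inner_sub_left, Complex.sub_re, h3] at h2
  linarith

theorem mul_add_min_mul_sq_le {a b p q : ℝ} (ha : 0 ≤ a) (hb : 0 ≤ b) (hp : 1 < p) (hq : 1 < q)
    (hpq : 1 / p + 1 / q = 1) :
    a * b + min (1 / p) (1 / q) * (a ^ (p / 2) - b ^ (q / 2)) ^ 2 ≤
      1 / p * a ^ p + 1 / q * b ^ q := by
  wlog h : p ≤ q generalizing a b p q
  · have := this hb ha hq hp (by linarith) (le_of_not_ge h)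
    rw [min_comm] at this
    linarith [show (a ^ (p / 2) - b ^ (q / 2)) ^ 2 = (b ^ (q / 2) - a ^ (p / 2)) ^ 2 by ring]
  have hp0 : 0 < p := by linarith
  have hq0 : 0 < q := by linarith
  have hle : 1 / q ≤ 1 / p := one_div_le_one_div_of_le hp0 h
  have hsq : ∀ {c r : ℝ}, 0 ≤ c → (c ^ (r / 2)) ^ 2 = c ^ r := fun {c r} hc => by
    rw [← Real.rpow_natCast, ← Real.rpow_mul hc]; congr 1; push_cast; ring
  have hgm := Real.geom_mean_le_arith_mean2_weighted (w₁ := 1 / p - 1 / q) (w₂ := 2 / q)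
    (p₁ := a ^ p) (p₂ := a ^ (p / 2) * b ^ (q / 2)) (by linarith) (by positivity)
    (by positivity) (by positivity) (by linarith [show 2 / q = 2 * (1 / q) by ring])
  have hab : (a ^ p) ^ (1 / p - 1 / q) * (a ^ (p / 2) * b ^ (q / 2)) ^ (2 / q) = a * b := by
    rw [Real.mul_rpow (by positivity) (by positivity), ← Real.rpow_mul ha, ← Real.rpow_mul ha,
      ← Real.rpow_mul hb, ← mul_assoc, ← Real.rpow_add_of_nonneg ha
        (mul_nonneg hp0.le (by linarith)) (by positivity)]
    rw [show p * (1 / p - 1 / q) + p / 2 * (2 / q) = 1 by field_simp; ring,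
      show q / 2 * (2 / q) = 1 by field_simp, Real.rpow_one, Real.rpow_one]
  rw [hab] at hgm
  rw [min_eq_right hle]
  have e : (a ^ (p / 2) - b ^ (q / 2)) ^ 2 = a ^ p + b ^ q - 2 * (a ^ (p / 2) * b ^ (q / 2)) := by
    rw [← hsq (r := p) ha, ← hsq (r := q) hb]; ring
  rw [e]
  calc _ ≤ (1 / p - 1 / q) * a ^ p + 2 / q * (a ^ (p / 2) * b ^ (q / 2)) +
        1 / q * (a ^ p + b ^ q - 2 * (a ^ (p / 2) * b ^ (q / 2))) := by gcongr
    _ = _ := by ring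

omit [CompleteSpace H] in
theorem re_inner_apply_self_le_norm {A : H →L[ℂ] H} {x : H} (hx : ‖x‖ = 1) : (⟪A x, x⟫_ℂ).re ≤ ‖A‖ :=
  calc _ ≤ ‖⟪A x, x⟫_ℂ‖ := Complex.re_le_norm _
    _ ≤ ‖A x‖ * ‖x‖ := norm_inner_le_norm _ _
    _ ≤ ‖A‖ := by simpa [hx] using A.le_opNorm x

theorem norm_inner_mul_opAbsPow_rpow_le (T : H →L[ℂ] H) {α β s : ℝ} (hα : 0 ≤ α) (hβ : 0 ≤ β)
    (hαβ : 1 ≤ α + β) (hs : 1 ≤ s) {x : H} (hx : ‖x‖ = 1) :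
    ‖⟪(T * opAbsPow T (α + β - 1)) x, x⟫_ℂ‖ ^ (2 * s) ≤
      (⟪opAbsPow T (2 * s * α) x, x⟫_ℂ).re * (⟪opAbsPow (star T) (2 * s * β) x, x⟫_ℂ).re := by
  have hs0 : 0 ≤ s := by linarith
  have key : ∀ (S : H →L[ℂ] H) {r : ℝ}, 0 ≤ r →
      ‖opAbsPow S r x‖ ^ (2 * s) ≤ (⟪opAbsPow S (2 * s * r) x, x⟫_ℂ).re := fun S r hr => by
    rw [Real.rpow_mul (norm_nonneg _), Real.rpow_two, norm_opAbsPow_apply_sq S hr,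
      show 2 * s * r = 2 * r * s by ring, ← opAbsPow_rpow S (by positivity) hs0]
    exact re_inner_rpow_le (opAbsPow_nonneg S _) hs hx
  calc _ ≤ (‖opAbsPow T α x‖ * ‖opAbsPow (star T) β x‖) ^ (2 * s) :=
        Real.rpow_le_rpow (norm_nonneg _) (norm_inner_mul_opAbsPow_le T hα hβ hαβ x x)
          (by positivity)
    _ = ‖opAbsPow T α x‖ ^ (2 * s) * ‖opAbsPow (star T) β x‖ ^ (2 * s) :=
        Real.mul_rpow (norm_nonneg _) (norm_nonneg _)
    _ ≤ _ := mul_le_mul (key T hα) (key (star T) hβ) (by positivity)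
        (re_inner_nonneg (opAbsPow_nonneg _ _) x)

theorem stmt10 [Nontrivial H] (T : H →L[ℂ] H) (α β : ℝ) (hα : 0 ≤ α) (hβ : 0 ≤ β)
    (hαβ : 1 ≤ α + β) (s : ℝ) (hs : 1 ≤ s) (p q : ℝ) (hp : 1 < p) (hq : 1 < q)
    (hpq : 1 / p + 1 / q = 1) :
    numRadius (T * opAbsPow T (α + β - 1)) ^ (2 * s) ≤
      ‖(1 / p : ℝ) • opAbsPow T (2 * s * p * α) + (1 / q : ℝ) • opAbsPow (star T) (2 * s * q * β)‖ -
        min (1 / p) (1 / q) *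
          ⨅ x : {x : H // ‖x‖ = 1},
            ((⟪(opAbsPow T (2 * s * α)) x.1, x.1⟫_ℂ).re ^ (p / 2) -
              (⟪(opAbsPow (star T) (2 * s * β)) x.1, x.1⟫_ℂ).re ^ (q / 2)) ^ 2 := by
  have hs0 : 0 < s := by linarith
  have hp0 : 0 < p := by linarith
  have hq0 : 0 < q := by linarith
  set N := (1 / p : ℝ) • opAbsPow T (2 * s * p * α) +
    (1 / q : ℝ) • opAbsPow (star T) (2 * s * q * β) with hN
  set f : {x : H // ‖x‖ = 1} → ℝ := fun x =>
    ((⟪(opAbsPow T (2 * s * α)) x.1, x.1⟫_ℂ).re ^ (p / 2) -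
      (⟪(opAbsPow (star T) (2 * s * β)) x.1, x.1⟫_ℂ).re ^ (q / 2)) ^ 2 with hf
  have hbdd : BddBelow (Set.range f) := ⟨0, by rintro _ ⟨x, rfl⟩; exact sq_nonneg _⟩
  have key : ∀ x : {x : H // ‖x‖ = 1},
      ‖⟪(T * opAbsPow T (α + β - 1)) x.1, x.1⟫_ℂ‖ ^ (2 * s) ≤
        ‖N‖ - min (1 / p) (1 / q) * ⨅ x, f x := by
    rintro ⟨x, hx⟩
    have h1 := norm_inner_mul_opAbsPow_rpow_le T hα hβ hαβ hs hx
    have h2 := mul_add_min_mul_sq_le (re_inner_nonneg (opAbsPow_nonneg T (2 * s * α)) x)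
      (re_inner_nonneg (opAbsPow_nonneg (star T) (2 * s * β)) x) hp hq hpq
    have h3 := re_inner_rpow_le (opAbsPow_nonneg T (2 * s * α)) hp.le hx
    have h4 := re_inner_rpow_le (opAbsPow_nonneg (star T) (2 * s * β)) hq.le hx
    rw [opAbsPow_rpow _ (by positivity) hp0.le, mul_right_comm _ α p] at h3
    rw [opAbsPow_rpow _ (by positivity) hq0.le, mul_right_comm _ β q] at h4
    have h5 : 1 / p * (⟪opAbsPow T (2 * s * p * α) x, x⟫_ℂ).re +
        1 / q * (⟪opAbsPow (star T) (2 * s * q * β) x, x⟫_ℂ).re ≤ ‖N‖ := by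
      refine le_of_eq_of_le ?_ (re_inner_apply_self_le_norm (A := N) hx)
      simp only [hN, add_apply, smul_apply,
        inner_add_left, ← Complex.coe_smul, inner_smul_left, Complex.conj_ofReal,
        Complex.add_re, Complex.re_ofReal_mul]
    have h6 : min (1 / p) (1 / q) * ⨅ x, f x ≤ min (1 / p) (1 / q) * f ⟨x, hx⟩ :=
      mul_le_mul_of_nonneg_left (ciInf_le hbdd _) (by positivity)
    have h7 := mul_le_mul_of_nonneg_left h3 (one_div_nonneg.mpr hp0.le)
    have h8 := mul_le_mul_of_nonneg_left h4 (one_div_nonneg.mpr hq0.le)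
    simp only [hf] at h6 ⊢
    linarith
  obtain ⟨x₀, hx₀⟩ := exists_norm_eq H zero_le_one
  have : Nonempty {x : H // ‖x‖ = 1} := ⟨⟨x₀, hx₀⟩⟩
  have hR : 0 ≤ ‖N‖ - min (1 / p) (1 / q) * ⨅ x, f x :=
    (by positivity : (0 : ℝ) ≤ _).trans (key ⟨x₀, hx₀⟩)
  have hsup : numRadius (T * opAbsPow T (α + β - 1)) ≤
      (‖N‖ - min (1 / p) (1 / q) * ⨅ x, f x) ^ (2 * s)⁻¹ :=
    ciSup_le fun x => (Real.le_rpow_inv_iff_of_pos (norm_nonneg _) hR (by positivity)).mpr (key x)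
  exact (Real.le_rpow_inv_iff_of_pos (Real.iSup_nonneg fun _ => norm_nonneg _) hR
    (by positivity)).mp hsup
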